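/- arXiv:2312.11981 — 2 statements merged into one kernel-verified Lean document; each statement's English description precedes it below -/
import Mathlib

section
/- Let d ≥ 1, Ω ⊆ ℝ^d be open and convex, F : Ω × ℝ^d → ℝ continuous, q ∈ [1,∞), and h₁, h₂, h₃ : [0,∞) → [0,∞) continuous with h_i(0) = 0, such that |F(y₁,p) − F(y₂,p)| ≤ h₁(|y₁−y₂|)|p|^q + h₂(|y₁−y₂|)|p| + h₃(|y₁−y₂|) for all y₁, y₂ ∈ Ω and p ∈ ℝ^d. Let φ : Ω → ℝ be continuous, bounded, and a viscosity super-solution of F(y, ∇φ(y)) = 0 in Ω. Then for every λ > 0, every x ∈ Ω^λ_φ, and every y ∈ A_λφ(x): F(x, (x−y)/λ) + h₁(|x−y|)·|x−y|^q/λ^q + h₂(|x−y|)·|x−y|/λ + h₃(|x−y|) ≥ 0. -/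
open Set Metric

/-- `v` is a viscosity super-solution of `F (y, ∇v y) = 0` on the open set `Ω`:
whenever `v - h` attains a local minimum relative to `Ω` at `x ∈ Ω` for a `C¹` test
function `h`, one has `F x (∇h x) ≥ 0`. -/
def IsViscositySupersolution {d : ℕ}
    (F : EuclideanSpace ℝ (Fin d) → EuclideanSpace ℝ (Fin d) → ℝ)
    (Ω : Set (EuclideanSpace ℝ (Fin d))) (v : EuclideanSpace ℝ (Fin d) → ℝ) : Prop :=
  ∀ x ∈ Ω, ∀ h : EuclideanSpace ℝ (Fin d) → ℝ, ContDiff ℝ 1 h →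
    IsLocalMinOn (fun y => v y - h y) Ω x → 0 ≤ F x (gradient h x)

/-- The gradient of the concave paraboloid `z ↦ -|x - z|² / (2λ)` at `y` is `(x - y) / λ`. -/
theorem hasGradientAt_neg_norm_sub_sq_div {E : Type*} [NormedAddCommGroup E]
    [InnerProductSpace ℝ E] [CompleteSpace E] (x y : E) (lam : ℝ) :
    HasGradientAt (fun z => -(‖x - z‖ ^ 2 / (2 * lam))) (lam⁻¹ • (x - y)) y := by
  rw [hasGradientAt_iff_hasFDerivAt]
  have hsq := (((hasFDerivAt_id y).const_sub x).norm_sq.mul_const (2 * lam)⁻¹).neg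
  refine (hsq.congr_fderiv ?_).congr_of_eventuallyEq (.of_forall fun z => by simp [div_eq_mul_inv])
  ext v
  simp
  ring

/-- Super-solution property transferred to points of the Moreau set:
for `x ∈ Ω^λ_φ` and any minimizer `y ∈ A_λφ(x)`,
`F(x, (x-y)/λ) + h₁(|x-y|)|x-y|^q/λ^q + h₂(|x-y|)|x-y|/λ + h₃(|x-y|) ≥ 0`. -/
theorem moreau_supersolution_estimate
    (d : ℕ) (hd : 1 ≤ d) (Ω : Set (EuclideanSpace ℝ (Fin d))) (hΩ : IsOpen Ω)
    (hΩconv : Convex ℝ Ω)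
    (F : EuclideanSpace ℝ (Fin d) → EuclideanSpace ℝ (Fin d) → ℝ)
    (hFcont : ContinuousOn (fun yp : EuclideanSpace ℝ (Fin d) × EuclideanSpace ℝ (Fin d) =>
      F yp.1 yp.2) (Ω ×ˢ univ))
    (q : ℝ) (hq : 1 ≤ q)
    (h₁ h₂ h₃ : ℝ → ℝ)
    (hhcont : ∀ i ∈ ({h₁, h₂, h₃} : Set (ℝ → ℝ)), ContinuousOn i (Ici 0))
    (hhnonneg : ∀ i ∈ ({h₁, h₂, h₃} : Set (ℝ → ℝ)), ∀ s ∈ Ici (0:ℝ), 0 ≤ i s)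
    (hhzero : h₁ 0 = 0 ∧ h₂ 0 = 0 ∧ h₃ 0 = 0)
    (hF : ∀ y₁ ∈ Ω, ∀ y₂ ∈ Ω, ∀ p : EuclideanSpace ℝ (Fin d),
      |F y₁ p - F y₂ p| ≤ h₁ ‖y₁ - y₂‖ * ‖p‖ ^ q + h₂ ‖y₁ - y₂‖ * ‖p‖ + h₃ ‖y₁ - y₂‖)
    (φ : EuclideanSpace ℝ (Fin d) → ℝ)
    (hφcont : ContinuousOn φ Ω)
    (hφbdd : ∃ M : ℝ, ∀ x ∈ Ω, |φ x| ≤ M)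
    (hsuper : IsViscositySupersolution F Ω φ)
    (lam : ℝ) (hlam : 0 < lam)
    (x : EuclideanSpace ℝ (Fin d)) (hxΩ : x ∈ Ω)
    (hxdist : 2 * Real.sqrt lam * Real.sqrt (sSup ((fun z => |φ z|) '' Ω)) ≤
      infDist x (frontier Ω))
    (y : EuclideanSpace ℝ (Fin d)) (hy : y ∈ Ω)
    (hmin : ∀ z ∈ Ω, φ y + ‖x - y‖ ^ 2 / (2 * lam) ≤ φ z + ‖x - z‖ ^ 2 / (2 * lam)) :
    0 ≤ F x (lam⁻¹ • (x - y)) + h₁ ‖x - y‖ * (‖x - y‖ ^ q / lam ^ q)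
      + h₂ ‖x - y‖ * (‖x - y‖ / lam) + h₃ ‖x - y‖ := by
  have hsub := hsuper y hy (fun z => -(‖x - z‖ ^ 2 / (2 * lam)))
    (((contDiff_const.sub contDiff_id).norm_sq ℝ).div_const _).neg
    (Filter.eventually_of_mem self_mem_nhdsWithin fun z hz => by
      simpa only [sub_neg_eq_add] using hmin z hz)
  rw [(hasGradientAt_neg_norm_sub_sq_div x y lam).gradient] at hsub
  have hnorm : ‖lam⁻¹ • (x - y)‖ = ‖x - y‖ / lam := by
    rw [norm_smul, norm_inv, Real.norm_of_nonneg hlam.le, inv_mul_eq_div]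
  have hdiff := hF x hxΩ y hy (lam⁻¹ • (x - y))
  rw [hnorm, Real.div_rpow (norm_nonneg _) hlam.le] at hdiff
  linarith [neg_abs_le (F x (lam⁻¹ • (x - y)) - F y (lam⁻¹ • (x - y)))]
end

section
/- Let d ≥ 1, Ω ⊆ ℝ^d be open and convex, F : Ω × ℝ^d → ℝ continuous, q ∈ [1,∞), and h₁, h₂, h₃ : [0,∞) → [0,∞) continuous with h_i(0) = 0, such that |F(y₁,p) − F(y₂,p)| ≤ h₁(|y₁−y₂|)|p|^q + h₂(|y₁−y₂|)|p| + h₃(|y₁−y₂|) for all y₁, y₂ ∈ Ω and p ∈ ℝ^d. Suppose moreover that there is C' > 0 with h_i(s) ≤ C's for all s ≥ 0 and i = 1,2,3, and that φ : Ω → ℝ is continuous, bounded, and α-Hölder continuous with some constant C > 0 and exponent α ∈ (1 − 1/q, 1]. Then for every compact set ω ⊂ Ω, sup_{x∈ω} g_λ(x) → 0 as λ → 0⁺, where g_λ(x) = sup_{y ∈ A_λφ(x)} [ h₁(|x−y|)·|x−y|^q/λ^q + h₂(|x−y|)·|x−y|/λ + h₃(|x−y|) ]. -/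
open Set Metric

/-- A Hölder bound on the decrease of the penalized functional controls the step length `r` by
the penalization parameter. -/
theorem rpow_two_sub_le_of_sq_div_le {r lam C α : ℝ} (hr : 0 < r) (hlam : 0 < lam)
    (h : r ^ 2 / (2 * lam) ≤ C * r ^ α) : r ^ (2 - α) ≤ 2 * C * lam := by
  have hrα : 0 < r ^ α := Real.rpow_pos_of_pos hr α
  rw [Real.rpow_sub hr, Real.rpow_two, div_le_iff₀ hrα]
  rw [div_le_iff₀ (by positivity)] at h
  linarith

/-- The Hölder step bound, rewritten as a bound on the slope `r / lam`. -/
theorem div_le_rpow_of_sq_div_le {r lam C α : ℝ} (hr : 0 < r) (hlam : 0 < lam)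
    (h : r ^ 2 / (2 * lam) ≤ C * r ^ α) : r / lam ≤ 2 * C * r ^ (α - 1) := by
  rw [Real.rpow_sub_one hr.ne', ← mul_div_assoc, le_div_iff₀ hr]
  calc r / lam * r = 2 * (r ^ 2 / (2 * lam)) := by field_simp
    _ ≤ 2 * C * r ^ α := by linarith

/-- A sum of positive powers is small near the origin. -/
theorem exists_pos_forall_rpow_add_le {a b α β : ℝ} (hα : 0 < α) (hβ : 0 < β) {ε : ℝ}
    (hε : 0 < ε) :
    ∃ δ > 0, ∀ r : ℝ, 0 ≤ r → r < δ → a * r ^ β + b * r ^ α + r ≤ ε := by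
  have hcont : Continuous fun r : ℝ => a * r ^ β + b * r ^ α + r :=
    ((continuous_const.mul (Real.continuous_rpow_const hβ.le)).add
      (continuous_const.mul (Real.continuous_rpow_const hα.le))).add continuous_id
  obtain ⟨δ, hδ, h⟩ := Metric.continuous_iff.1 hcont 0 ε hε
  refine ⟨δ, hδ, fun r hr hrδ => ?_⟩
  have := h r (by simpa [abs_of_nonneg hr] using hrδ)
  simp only [Real.zero_rpow hβ.ne', Real.zero_rpow hα.ne', mul_zero, add_zero,
    Real.dist_eq, sub_zero] at this
  exact (le_abs_self _).trans this.le

/-- Under linear bounds `h_i(s) ≤ C'·s` and `α`-Hölder continuity of `φ`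
with `α ∈ (1 - 1/q, 1]`, the error term
`g_λ(x) = sup_{y ∈ A_λφ(x)} [h₁(|x-y|)|x-y|^q/λ^q + h₂(|x-y|)|x-y|/λ + h₃(|x-y|)]`
tends to `0` as `λ → 0⁺`, uniformly on compact subsets `ω ⊂ Ω`. -/
theorem moreau_error_tendsto_zero
    (d : ℕ) (hd : 1 ≤ d) (Ω : Set (EuclideanSpace ℝ (Fin d))) (hΩ : IsOpen Ω)
    (hΩconv : Convex ℝ Ω)
    (F : EuclideanSpace ℝ (Fin d) → EuclideanSpace ℝ (Fin d) → ℝ)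
    (hFcont : ContinuousOn (fun yp : EuclideanSpace ℝ (Fin d) × EuclideanSpace ℝ (Fin d) =>
      F yp.1 yp.2) (Ω ×ˢ univ))
    (q : ℝ) (hq : 1 ≤ q)
    (h₁ h₂ h₃ : ℝ → ℝ)
    (hhcont : ∀ i ∈ ({h₁, h₂, h₃} : Set (ℝ → ℝ)), ContinuousOn i (Ici 0))
    (hhnonneg : ∀ i ∈ ({h₁, h₂, h₃} : Set (ℝ → ℝ)), ∀ s ∈ Ici (0:ℝ), 0 ≤ i s)
    (hhzero : h₁ 0 = 0 ∧ h₂ 0 = 0 ∧ h₃ 0 = 0)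
    (hF : ∀ y₁ ∈ Ω, ∀ y₂ ∈ Ω, ∀ p : EuclideanSpace ℝ (Fin d),
      |F y₁ p - F y₂ p| ≤ h₁ ‖y₁ - y₂‖ * ‖p‖ ^ q + h₂ ‖y₁ - y₂‖ * ‖p‖ + h₃ ‖y₁ - y₂‖)
    (C' : ℝ) (hC' : 0 < C')
    (hlin : ∀ i ∈ ({h₁, h₂, h₃} : Set (ℝ → ℝ)), ∀ s : ℝ, 0 ≤ s → i s ≤ C' * s)
    (α : ℝ) (hα1 : α ≤ 1) (hαq : 1 - 1 / q < α)
    (C : ℝ) (hC : 0 < C)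
    (φ : EuclideanSpace ℝ (Fin d) → ℝ)
    (hφcont : ContinuousOn φ Ω)
    (hφbdd : ∃ M : ℝ, ∀ x ∈ Ω, |φ x| ≤ M)
    (hφhold : ∀ x₁ ∈ Ω, ∀ x₂ ∈ Ω, |φ x₁ - φ x₂| ≤ C * ‖x₁ - x₂‖ ^ α)
    (ω : Set (EuclideanSpace ℝ (Fin d))) (hω : IsCompact ω) (hωΩ : ω ⊆ Ω) :
    ∀ ε > 0, ∃ lam₀ > 0, ∀ lam : ℝ, 0 < lam → lam < lam₀ →
      ∀ x ∈ ω, ∀ y ∈ Ω,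
        (∀ z ∈ Ω, φ y + ‖x - y‖ ^ 2 / (2 * lam) ≤ φ z + ‖x - z‖ ^ 2 / (2 * lam)) →
        h₁ ‖x - y‖ * (‖x - y‖ ^ q / lam ^ q) + h₂ ‖x - y‖ * (‖x - y‖ / lam)
          + h₃ ‖x - y‖ ≤ ε := by
  intro ε hε
  have hq0 : 0 < q := by linarith
  have hα0 : 0 < α := by
    have : 1 / q ≤ 1 := (div_le_one hq0).2 hq
    linarith
  have hβ : 0 < 1 + (α - 1) * q := by
    have := mul_lt_mul_of_pos_right hαq hq0
    rw [sub_mul, div_mul_cancel₀ _ hq0.ne'] at this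
    linarith
  obtain ⟨δ, hδ, hsmall⟩ := exists_pos_forall_rpow_add_le (a := (2 * C) ^ q) (b := 2 * C) hα0 hβ
    (div_pos hε hC')
  refine ⟨δ ^ (2 - α) / (2 * C), by positivity, fun lam hlam hlam_lt x hx y hy hmin => ?_⟩
  have hmem : x ∈ Ω := hωΩ hx
  have hstep : ‖x - y‖ ^ 2 / (2 * lam) ≤ C * ‖x - y‖ ^ α := by
    have h := hmin x hmem
    simp only [sub_self, norm_zero, ne_eq, OfNat.ofNat_ne_zero, not_false_eq_true, zero_pow,
      zero_div, add_zero] at h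
    linarith [le_abs_self (φ x - φ y), hφhold x hmem y hy]
  have hlin₁ := hlin h₁ (by simp) ‖x - y‖ (norm_nonneg _)
  have hlin₂ := hlin h₂ (by simp) ‖x - y‖ (norm_nonneg _)
  have hlin₃ := hlin h₃ (by simp) ‖x - y‖ (norm_nonneg _)
  rcases (norm_nonneg (x - y)).eq_or_lt with hr | hr
  · simp [← hr, hhzero, hε.le]
  generalize ‖x - y‖ = r at *
  have hrδ : r < δ := by
    have h := rpow_two_sub_le_of_sq_div_le hr hlam hstep
    rw [lt_div_iff₀ (by positivity)] at hlam_lt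
    exact (Real.rpow_lt_rpow_iff hr.le hδ.le (by linarith : 0 < 2 - α)).1 (by linarith)
  have hslope := div_le_rpow_of_sq_div_le hr hlam hstep
  have hpow : r * (r ^ q / lam ^ q) ≤ (2 * C) ^ q * r ^ (1 + (α - 1) * q) := by
    rw [← Real.div_rpow hr.le hlam.le]
    calc r * (r / lam) ^ q ≤ r * (2 * C * r ^ (α - 1)) ^ q := by gcongr
      _ = (2 * C) ^ q * r ^ (1 + (α - 1) * q) := by
        rw [Real.mul_rpow (by positivity) (by positivity), ← Real.rpow_mul hr.le,
          Real.rpow_add hr, Real.rpow_one]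
        ring
  have hmul : r * (r / lam) ≤ 2 * C * r ^ α := by
    calc r * (r / lam) ≤ r * (2 * C * r ^ (α - 1)) := by gcongr
      _ = 2 * C * r ^ α := by
        rw [Real.rpow_sub_one hr.ne']
        field_simp
  calc h₁ r * (r ^ q / lam ^ q) + h₂ r * (r / lam) + h₃ r
      ≤ C' * r * (r ^ q / lam ^ q) + C' * r * (r / lam) + C' * r := by gcongr
    _ = C' * (r * (r ^ q / lam ^ q) + r * (r / lam) + r) := by ring
    _ ≤ C' * ((2 * C) ^ q * r ^ (1 + (α - 1) * q) + 2 * C * r ^ α + r) := by gcongr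
    _ ≤ C' * (ε / C') := by gcongr; exact hsmall r hr.le hrδ
    _ = ε := mul_div_cancel₀ _ hC'.ne'
end
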